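/- arXiv:2408.10558 — 3 statements merged into one kernel-verified Lean document; each statement's English description precedes it below -/
import Mathlib

section
/- Let f : ℝ^M → ℝ be twice continuously differentiable with μ I ⪯ ∇²f(x) ⪯ L I for all x, where 0 < μ ≤ L, and let x̂ be the (unique) global minimizer of f. Then the gradient descent iterates x^{t+1} = x^t − η ∇f(x^t) with step size η = 1/L satisfy ‖x^t − x̂‖_2 ≤ (1 − μ/L)^t ‖x^0 − x̂‖_2 for every t ≥ 0. -/
open scoped BigOperators

/-- A symmetric bilinear form `B` with `0 ≤ B v v ≤ c ‖v‖ ^ 2` has operator norm at most `c`. -/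
theorem ContinuousLinearMap.opNorm_le_of_symm_of_quadratic_bound {E : Type*}
    [NormedAddCommGroup E] [NormedSpace ℝ E] (B : E →L[ℝ] E →L[ℝ] ℝ) {c : ℝ} (hc : 0 ≤ c)
    (hsymm : ∀ u v, B u v = B v u) (hnonneg : ∀ v, 0 ≤ B v v)
    (hle : ∀ v, B v v ≤ c * ‖v‖ ^ 2) : ‖B‖ ≤ c := by
  refine B.opNorm_le_bound₂ hc fun u v => abs_le_of_sq_le_sq ?_ (by positivity)
  have hCS : B u v ^ 2 ≤ B u u * B v v :=
    LinearMap.BilinForm.apply_sq_le_of_symm B.toLinearMap₁₂ hnonneg ⟨fun u v => hsymm u v⟩ u v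
  calc B u v ^ 2 ≤ B u u * B v v := hCS
    _ ≤ (c * ‖u‖ ^ 2) * (c * ‖v‖ ^ 2) :=
      mul_le_mul (hle u) (hle v) (hnonneg v) (by positivity)
    _ = (c * ‖u‖ * ‖v‖) ^ 2 := by ring

/-- The gradient step with step size `1 / L` is a contraction with factor `1 - mu / L`. -/
theorem norm_gradient_step_sub_le {E : Type*} [NormedAddCommGroup E] [InnerProductSpace ℝ E]
    [CompleteSpace E] {f : E → ℝ} {mu L : ℝ} (hL : 0 < L) (hmuL : mu ≤ L)
    (hf : ContDiff ℝ 2 f)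
    (hHess : ∀ z v : E,
      mu * ‖v‖ ^ 2 ≤ iteratedFDeriv ℝ 2 f z (fun _ => v) ∧
      iteratedFDeriv ℝ 2 f z (fun _ => v) ≤ L * ‖v‖ ^ 2) (y z : E) :
    ‖(y - (1 / L) • gradient f y) - (z - (1 / L) • gradient f z)‖
      ≤ (1 - mu / L) * ‖y - z‖ := by
  let J : E →L[ℝ] E →L[ℝ] ℝ := innerSL ℝ
  have hJ (u v : E) : J u v = inner ℝ u v := rfl
  have hderiv (w : E) : HasFDerivAt (fun u => J u - (1 / L) • fderiv ℝ f u)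
      (J - (1 / L) • fderiv ℝ (fderiv ℝ f) w) w := by
    have hd : DifferentiableAt ℝ (fderiv ℝ f) w :=
      (hf.fderiv_right (m := 1) (by norm_num)).differentiable (by norm_num) w
    exact J.hasFDerivAt.sub (hd.hasFDerivAt.const_smul (1 / L))
  have hbound (w : E) : ‖J - (1 / L) • fderiv ℝ (fderiv ℝ f) w‖ ≤ 1 - mu / L := by
    have hquad (v : E) : (J - (1 / L) • fderiv ℝ (fderiv ℝ f) w) v v
        = ‖v‖ ^ 2 - iteratedFDeriv ℝ 2 f w (fun _ => v) / L := by
      simp [hJ, iteratedFDeriv_two_apply]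
      ring
    refine ContinuousLinearMap.opNorm_le_of_symm_of_quadratic_bound _
      (sub_nonneg.2 ((div_le_one hL).2 hmuL)) (fun u v => ?_) (fun v => ?_) (fun v => ?_)
    · have hs := (hf.contDiffAt (x := w)).isSymmSndFDerivAt (by simp) u v
      simp [hJ, hs, real_inner_comm]
    · rw [hquad, sub_nonneg, div_le_iff₀ hL]
      linarith [(hHess w v).2]
    · have h := div_le_div_of_nonneg_right (hHess w v).1 hL.le
      rw [hquad]
      linear_combination h
  have hmvt := convex_univ.norm_image_sub_le_of_norm_hasFDerivWithin_le
    (fun w _ => (hderiv w).hasFDerivWithinAt) (fun w _ => hbound w)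
    (Set.mem_univ z) (Set.mem_univ y)
  have hdual (w : E) : J w - (1 / L) • fderiv ℝ f w
      = InnerProductSpace.toDual ℝ E (w - (1 / L) • gradient f w) := by
    ext v
    simp [hJ, gradient]
  rwa [hdual, hdual, ← map_sub, LinearIsometryEquiv.norm_map] at hmvt

/-- linear convergence of gradient descent with step size `1/L`
for a twice continuously differentiable function whose Hessian satisfies
`μ I ⪯ ∇²f(x) ⪯ L I` everywhere (`0 < μ ≤ L`), towards the global minimizer. -/
theorem stmt_12 (M : ℕ) (mu L : ℝ)
    (f : EuclideanSpace ℝ (Fin M) → ℝ)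
    (x : ℕ → EuclideanSpace ℝ (Fin M)) (xhat : EuclideanSpace ℝ (Fin M))
    (hmu : 0 < mu) (hmuL : mu ≤ L)
    (hf : ContDiff ℝ 2 f)
    (hHess : ∀ z v : EuclideanSpace ℝ (Fin M),
      mu * ‖v‖ ^ 2 ≤ iteratedFDeriv ℝ 2 f z (fun _ => v) ∧
      iteratedFDeriv ℝ 2 f z (fun _ => v) ≤ L * ‖v‖ ^ 2)
    (hmin : ∀ y, f xhat ≤ f y)
    (hiter : ∀ t : ℕ, x (t + 1) = x t - (1 / L) • gradient f (x t)) :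
    ∀ t : ℕ, ‖x t - xhat‖ ≤ (1 - mu / L) ^ t * ‖x 0 - xhat‖ := by
  have hL : 0 < L := hmu.trans_le hmuL
  have hgrad : gradient f xhat = 0 := by
    have hzero : fderiv ℝ f xhat = 0 :=
      IsLocalMin.fderiv_eq_zero (Filter.Eventually.of_forall hmin)
    simp [gradient, hzero]
  intro t
  induction t with
  | zero => simp
  | succ t ih =>
    have hstep := norm_gradient_step_sub_le hL hmuL hf hHess (x t) xhat
    rw [hgrad, smul_zero, sub_zero, ← hiter] at hstep
    calc ‖x (t + 1) - xhat‖ ≤ (1 - mu / L) * ‖x t - xhat‖ := hstep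
      _ ≤ (1 - mu / L) * ((1 - mu / L) ^ t * ‖x 0 - xhat‖) :=
        mul_le_mul_of_nonneg_left ih (sub_nonneg.2 ((div_le_one hL).2 hmuL))
      _ = (1 - mu / L) ^ (t + 1) * ‖x 0 - xhat‖ := by ring
end

section
/- Let A be a real symmetric M×M matrix with A 1_M = 0, and let λ_1 ≥ … ≥ λ_{M−1} be the eigenvalues of A restricted to the orthogonal complement of 1_M. Then the (M+1)×(M+1) bordered matrix B = [[A, 1_M],[1_Mᵀ, 0]] has eigenvalues exactly λ_1, …, λ_{M−1}, √M, and −√M (with multiplicity). In particular, if 0 < λ_{M−1} ≤ √M, then B is invertible and ‖B^{−1}‖_2 = 1/λ_{M−1}, where ‖·‖_2 is the spectral norm. -/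
open Polynomial Matrix
open scoped BigOperators

/-- The bordered matrix `[[A, 1_M],[1_Mᵀ, 0]]`. -/
noncomputable def bordered {M : ℕ} (A : Matrix (Fin M) (Fin M) ℝ) :
    Matrix (Fin (M + 1)) (Fin (M + 1)) ℝ :=
  Matrix.of fun i j =>
    if hi : (i : ℕ) < M then
      if hj : (j : ℕ) < M then A ⟨i, hi⟩ ⟨j, hj⟩ else 1
    else if (j : ℕ) < M then 1 else 0

/-- The ℓ₂→ℓ₂ operator (spectral) norm of a real square matrix. -/
noncomputable def specNorm {M : ℕ} (A : Matrix (Fin M) (Fin M) ℝ) : ℝ :=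
  ‖Matrix.toEuclideanCLM (𝕜 := ℝ) A‖

/-- Row and column bordering of a square matrix by all-ones vectors, in block form. -/
lemma bordered_eq_reindex_fromBlocks {M : ℕ} (A : Matrix (Fin M) (Fin M) ℝ) :
    bordered A = Matrix.reindex finSumFinEquiv finSumFinEquiv
      (Matrix.fromBlocks A (Matrix.of fun _ (_ : Fin 1) => 1) (Matrix.of fun _ _ => 1) 0) := by
  rw [← Equiv.symm_apply_eq]
  ext i j
  rcases i with i | i <;> rcases j with j | j <;> simp [bordered]

/-- A matrix with zero row sums has the all-ones vector as an eigenvector of its characteristic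
matrix, with eigenvalue `X`. -/
lemma charmatrix_mul_ones {M : ℕ} {A : Matrix (Fin M) (Fin M) ℝ}
    (hA : A.mulVec (fun _ => (1 : ℝ)) = 0) :
    A.charmatrix * (Matrix.of fun _ _ => 1 : Matrix (Fin M) (Fin 1) ℝ[X]) =
      Matrix.of fun _ _ => X := by
  ext1 i j
  have h : ∑ k, A i k = 0 := by simpa [Matrix.mulVec, dotProduct] using congrFun hA i
  simp [Matrix.mul_apply, charmatrix_apply, Matrix.diagonal_apply, Finset.sum_sub_distrib,
    ← map_sum, h]

lemma X_mul_charpoly_bordered {M : ℕ} {A : Matrix (Fin M) (Fin M) ℝ}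
    (hA : A.mulVec (fun _ => (1 : ℝ)) = 0) :
    X * (bordered A).charpoly = A.charpoly * (X ^ 2 - C (M : ℝ)) := by
  have key : (Matrix.fromBlocks A (Matrix.of fun _ (_ : Fin 1) => (1 : ℝ))
        (Matrix.of fun _ _ => 1) 0).charmatrix *
      Matrix.fromBlocks 1 (Matrix.of fun _ (_ : Fin 1) => 1) 0 (Matrix.of fun _ _ => X) =
      Matrix.fromBlocks A.charmatrix 0 (Matrix.of fun _ _ => -1)
        (Matrix.of fun _ (_ : Fin 1) => X ^ 2 - C (M : ℝ)) := by
    rw [charmatrix_fromBlocks, Matrix.fromBlocks_multiply, charmatrix_mul_ones hA]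
    congr 1
    · simp
    · ext1 i j
      simp [Matrix.mul_apply]
    · ext1 i j
      simp
    · ext1 i j
      have hi : i = 0 := Subsingleton.elim i 0
      simp [Matrix.mul_apply, hi]
      ring
  have hdet := congrArg Matrix.det key
  rw [Matrix.det_mul, Matrix.det_fromBlocks_zero₁₂, Matrix.det_fromBlocks_zero₂₁] at hdet
  rw [bordered_eq_reindex_fromBlocks, charpoly_reindex, mul_comm]
  simpa [Matrix.charpoly] using hdet

lemma isHermitian_bordered {M : ℕ} {A : Matrix (Fin M) (Fin M) ℝ} (hA : Aᵀ = A) :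
    (bordered A).IsHermitian := by
  rw [bordered_eq_reindex_fromBlocks]
  have hA' : Aᴴ = A := by rw [conjTranspose_eq_transpose_of_trivial, hA]
  refine IsHermitian.submatrix (IsHermitian.fromBlocks hA' ?_ (by simp)) _
  ext i j
  simp

open scoped Matrix.Norms.L2Operator in
/-- The spectral norm of the inverse of a Hermitian matrix is the reciprocal of the smallest
absolute value of its eigenvalues. -/
lemma specNorm_inv_of_isHermitian {n : ℕ} {B : Matrix (Fin n) (Fin n) ℝ} (hB : B.IsHermitian)
    {c : ℝ} (hc : 0 < c) (hle : ∀ i, c ≤ |hB.eigenvalues i|)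
    (hex : ∃ i, hB.eigenvalues i = c) : specNorm B⁻¹ = c⁻¹ := by
  have hne : ∀ i, hB.eigenvalues i ≠ 0 := fun i => abs_pos.mp (hc.trans_le (hle i))
  have hinv : B⁻¹ = Unitary.conjStarAlgAut ℝ _ hB.eigenvectorUnitary
      (diagonal fun i => (hB.eigenvalues i)⁻¹) := by
    apply Matrix.inv_eq_right_inv
    conv_lhs => enter [1]; rw [hB.spectral_theorem]
    rw [← map_mul, diagonal_mul_diagonal]
    simp [hne]
  rw [specNorm, ← Matrix.cstar_norm_def, hinv, Unitary.conjStarAlgAut_apply,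
    CStarRing.norm_mul_mem_unitary _ (Unitary.star_mem hB.eigenvectorUnitary.2),
    CStarRing.norm_coe_unitary_mul, l2_opNorm_diagonal]
  apply le_antisymm
  · refine (pi_norm_le_iff_of_nonneg (inv_nonneg.mpr hc.le)).mpr fun i => ?_
    rw [norm_inv, Real.norm_eq_abs]
    exact inv_anti₀ hc (hle i)
  · obtain ⟨i, hi⟩ := hex
    have h := norm_le_pi_norm (fun i => (hB.eigenvalues i)⁻¹) i
    rwa [hi, Real.norm_of_nonneg (inv_nonneg.mpr hc.le)] at h

/-- eigenvalues of the bordered matrix `B = [[A, 1],[1ᵀ, 0]]` for a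
symmetric `A` with `A 1 = 0` and eigenvalues `0, ev 0 ≥ … ≥ ev (M−2)` (encoded via the
characteristic polynomial) are exactly `ev 0, …, ev (M−2), √M, −√M`; in particular, if
`0 < ev (M−2) ≤ √M` then `B` is invertible with spectral norm `‖B⁻¹‖₂ = 1/ev (M−2)`. -/
theorem stmt_17 (m : ℕ) (A : Matrix (Fin (m + 2)) (Fin (m + 2)) ℝ)
    (ev : Fin (m + 1) → ℝ)
    (hsymm : Aᵀ = A)
    (hA1 : A.mulVec (fun _ => (1 : ℝ)) = 0)
    (hmono : Antitone ev)
    (hchar : A.charpoly = X * ∏ i, (X - C (ev i))) :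
    (bordered A).charpoly = (X ^ 2 - C ((m + 2 : ℕ) : ℝ)) * ∏ i, (X - C (ev i)) ∧
    (0 < ev (Fin.last m) → ev (Fin.last m) ≤ Real.sqrt ((m + 2 : ℕ) : ℝ) →
      IsUnit (bordered A).det ∧
      specNorm ((bordered A)⁻¹) = (ev (Fin.last m))⁻¹) := by
  have hcp : (bordered A).charpoly =
      (X ^ 2 - C ((m + 2 : ℕ) : ℝ)) * ∏ i, (X - C (ev i)) := by
    apply mul_left_cancel₀ (X_ne_zero (R := ℝ))
    rw [X_mul_charpoly_bordered hA1, hchar]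
    ring
  refine ⟨hcp, fun hpos hsqrt => ?_⟩
  have hB := isHermitian_bordered hsymm
  have hroot : ∀ x : ℝ, (∃ i, hB.eigenvalues i = x) ↔
      x ^ 2 = ((m + 2 : ℕ) : ℝ) ∨ ∃ i, ev i = x := by
    intro x
    have h := congrArg (eval x) (hB.charpoly_eq.symm.trans hcp)
    simp only [eval_prod, eval_mul, eval_sub, eval_pow, eval_X, eval_C] at h
    have h0 : ∏ i, (x - hB.eigenvalues i) = 0 ↔
        (x ^ 2 - ((m + 2 : ℕ) : ℝ)) * ∏ i, (x - ev i) = 0 := by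
      rw [← h]
      rfl
    simpa only [mul_eq_zero, Finset.prod_eq_zero_iff, Finset.mem_univ, true_and, sub_eq_zero,
      @eq_comm _ x] using h0
  have hle : ∀ i, ev (Fin.last m) ≤ |hB.eigenvalues i| := by
    intro i
    rcases (hroot _).mp ⟨i, rfl⟩ with h | ⟨j, hj⟩
    · rwa [← Real.sqrt_sq_eq_abs, h]
    · rw [← hj]
      exact (hmono (Fin.le_last j)).trans (le_abs_self _)
  refine ⟨?_, specNorm_inv_of_isHermitian hB hpos hle ((hroot _).mpr (Or.inr ⟨_, rfl⟩))⟩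
  rw [isUnit_iff_ne_zero, hB.det_eq_prod_eigenvalues]
  exact Finset.prod_ne_zero_iff.mpr fun i _ => abs_pos.mp (hpos.trans_le (hle i))
end

section
/- Let H be a real symmetric M×M matrix with H 1_M = 0 that is positive definite on the orthogonal complement of 1_M, with eigenvalues λ_1 ≥ … ≥ λ_{M−1} > 0 on 1_M^⊥. Then the bordered matrix B = [[H, 1_M],[1_Mᵀ, 0]] is invertible and its inverse has the block form B^{−1} = [[Θ, (1/M)1_M],[(1/M)1_Mᵀ, 0]], where Θ is symmetric and satisfies: (i) Θ 1_M = 0; (ii) Θ H Θ = Θ; (iii) the eigenvalues of Θ are 1/λ_{M−1} ≥ … ≥ 1/λ_1 together with 0 (eigenvector 1_M), so ‖Θ‖_2 = 1/λ_{M−1}; and (iv) for every 1 ≤ k ≤ M, (1 − 1/M)/λ_1 ≤ Θ_{kk} ≤ 1/λ_{M−1}. -/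
open Polynomial Matrix
open scoped BigOperators

/-- A real symmetric matrix is orthogonally diagonalizable with any prescribed ordering of its
eigenvalues. -/
theorem exists_unitary_conj_diagonal {n : Type*} [Fintype n] [DecidableEq n]
    {A : Matrix n n ℝ} (hA : A.IsHermitian) {d : n → ℝ}
    (h : A.charpoly = ∏ i, (X - C (d i))) :
    ∃ U ∈ Matrix.unitaryGroup n ℝ, A = U * diagonal d * star U := by
  have hD : (diagonal d).IsHermitian := isHermitian_diagonal d
  have he : hA.eigenvalues = hD.eigenvalues :=
    (hA.eigenvalues_eq_eigenvalues_iff hD).2 (by rw [h, charpoly_diagonal])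
  refine ⟨hA.eigenvectorUnitary * star hD.eigenvectorUnitary,
    mul_mem hA.eigenvectorUnitary.2 (Unitary.star_mem hD.eigenvectorUnitary.2), ?_⟩
  have hd := hD.conjStarAlgAut_star_eigenvectorUnitary
  have ha := hA.spectral_theorem
  rw [he, ← hd, Unitary.conjStarAlgAut_star_apply, Unitary.conjStarAlgAut_apply] at ha
  conv_lhs => rw [ha]
  simp [mul_assoc]

theorem charpoly_unitary_conj_diagonal {n : Type*} [Fintype n] [DecidableEq n]
    {U : Matrix n n ℝ} (hU : U ∈ Matrix.unitaryGroup n ℝ) (d : n → ℝ) :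
    (U * diagonal d * star U).charpoly = ∏ i, (X - C (d i)) := by
  rw [charpoly_mul_comm, ← mul_assoc, mem_unitaryGroup_iff'.1 hU, one_mul, charpoly_diagonal]

open scoped Matrix.Norms.L2Operator in
theorem specNorm_unitary_conj_diagonal {M : ℕ} {U : Matrix (Fin M) (Fin M) ℝ}
    (hU : U ∈ Matrix.unitaryGroup (Fin M) ℝ) (d : Fin M → ℝ) :
    specNorm (U * diagonal d * star U) = ‖d‖ := by
  rw [specNorm, ← cstar_norm_def, CStarRing.norm_mul_mem_unitary _ (Unitary.star_mem hU),
    CStarRing.norm_mem_unitary_mul _ hU, l2_opNorm_diagonal]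

theorem unitary_conj_diagonal_apply {n : Type*} [Fintype n] [DecidableEq n]
    (U : Matrix n n ℝ) (d : n → ℝ) (k l : n) :
    (U * diagonal d * star U) k l = ∑ j, d j * (U k j * U l j) := by
  rw [mul_apply]
  refine Finset.sum_congr rfl fun j _ => ?_
  rw [mul_diagonal, star_apply, star_trivial]
  ring

/-- If the constant vector is in the kernel of an orthogonally diagonalized matrix whose only zero
eigenvalue has index `0`, then the column of index `0` is constant. -/
theorem column_zero_mul {m : ℕ} {U : Matrix (Fin (m + 1)) (Fin (m + 1)) ℝ}
    (hU : U ∈ Matrix.unitaryGroup (Fin (m + 1)) ℝ) {d : Fin (m + 1) → ℝ}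
    (hd : ∀ i, i ≠ 0 → d i ≠ 0)
    (h1 : (U * diagonal d * star U).mulVec (fun _ => (1 : ℝ)) = 0) (k l : Fin (m + 1)) :
    U k 0 * U l 0 = 1 / ((m + 1 : ℕ) : ℝ) := by
  set w := (star U).mulVec (fun _ => (1 : ℝ)) with hw
  have hUU := mem_unitaryGroup_iff'.1 hU
  have hdw : ∀ j, d j * w j = 0 := by
    have : (diagonal d).mulVec w = 0 := by
      have := congrArg (star U).mulVec h1
      rwa [mulVec_zero, mulVec_mulVec, mul_assoc, ← mul_assoc, hUU, one_mul, ← mulVec_mulVec]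
        at this
    intro j
    simpa [mulVec_diagonal] using congrFun this j
  have hk : ∀ k, U k 0 * w 0 = 1 := by
    intro k
    have : U.mulVec w = fun _ => (1 : ℝ) := by
      rw [hw, mulVec_mulVec, mem_unitaryGroup_iff.1 hU, one_mulVec]
    have := congrFun this k
    rwa [mulVec, dotProduct, Finset.sum_eq_single 0 (fun j _ hj => by
      rw [(mul_eq_zero.1 (hdw j)).resolve_left (hd j hj), mul_zero]) (by simp)] at this
  have hw0 : w 0 ≠ 0 := fun h => by simpa [h] using hk 0
  have hval : ∀ k, U k 0 = (w 0)⁻¹ := fun k => eq_inv_of_mul_eq_one_left (hk k)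
  have hs : w 0 = (m + 1 : ℕ) * (w 0)⁻¹ := by
    conv_lhs => rw [hw]
    simp [mulVec, dotProduct, star_apply, hval]
  rw [hval, hval]
  have : w 0 * w 0 = (m + 1 : ℕ) := by
    field_simp at hs
    rw [← hs]; ring
  rw [← this]
  field_simp

section bordered

variable {M : ℕ} (A : Matrix (Fin M) (Fin M) ℝ)

@[simp] theorem bordered_castSucc_castSucc (i j : Fin M) :
    bordered A i.castSucc j.castSucc = A i j := by
  simp [bordered]

@[simp] theorem bordered_castSucc_last (i : Fin M) :
    bordered A i.castSucc (Fin.last M) = 1 := by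
  simp [bordered]

@[simp] theorem bordered_last_castSucc (j : Fin M) :
    bordered A (Fin.last M) j.castSucc = 1 := by
  simp [bordered]

@[simp] theorem bordered_last_last : bordered A (Fin.last M) (Fin.last M) = 0 := by
  simp [bordered]

end bordered

/-- The block matrix `[[T, c 1], [c 1ᵀ, 0]]`. -/
noncomputable def scaledBordered {M : ℕ} (c : ℝ) (T : Matrix (Fin M) (Fin M) ℝ) :
    Matrix (Fin (M + 1)) (Fin (M + 1)) ℝ :=
  Matrix.of fun i j =>
    Fin.lastCases (motive := fun _ => ℝ)
      (Fin.lastCases (motive := fun _ => ℝ) 0 (fun _ => c) j)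
      (fun k => Fin.lastCases (motive := fun _ => ℝ) c (fun l => T k l) j) i

theorem bordered_mul_scaledBordered {M : ℕ} (hM : M ≠ 0) {A T : Matrix (Fin M) (Fin M) ℝ}
    (hA : A.mulVec (fun _ => (1 : ℝ)) = 0) (hT : Tᵀ.mulVec (fun _ => (1 : ℝ)) = 0)
    (hAT : ∀ k l, (A * T) k l = (1 : Matrix (Fin M) (Fin M) ℝ) k l - 1 / (M : ℝ)) :
    bordered A * scaledBordered (1 / (M : ℝ)) T = 1 := by
  have hM' : (M : ℝ) ≠ 0 := Nat.cast_ne_zero.2 hM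
  ext i j
  rw [mul_apply, Fin.sum_univ_castSucc]
  refine Fin.lastCases ?_ (fun k => ?_) i <;> refine Fin.lastCases ?_ (fun l => ?_) j
  · simp [scaledBordered, hM']
  · have := congrFun hT l
    simp only [mulVec, dotProduct, transpose_apply, mul_one, Pi.zero_apply] at this
    simp [scaledBordered, this, one_apply, (Fin.castSucc_lt_last l).ne']
  · have := congrFun hA k
    simp only [mulVec, dotProduct, mul_one, Pi.zero_apply] at this
    simp [scaledBordered, ← Finset.sum_mul, this, one_apply, (Fin.castSucc_lt_last k).ne]
  · have := hAT k l
    rw [mul_apply] at this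
    simp [scaledBordered, this, one_apply]

theorem norm_cons_zero_inv {m : ℕ} {ev : Fin (m + 1) → ℝ} (hmono : Antitone ev)
    (hpos : ∀ i, 0 < ev i) :
    ‖(Fin.cons 0 fun i => (ev i)⁻¹ : Fin (m + 2) → ℝ)‖ = (ev (Fin.last m))⁻¹ := by
  have h0 : 0 ≤ (ev (Fin.last m))⁻¹ := (inv_pos.2 (hpos _)).le
  refine le_antisymm ((pi_norm_le_iff_of_nonneg h0).2 fun i => ?_) ?_
  · refine Fin.cases (by simpa using h0) (fun j => ?_) i
    rw [Fin.cons_succ, Real.norm_of_nonneg (inv_pos.2 (hpos j)).le]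
    exact inv_anti₀ (hpos _) (hmono (Fin.le_last j))
  · have := norm_le_pi_norm (Fin.cons 0 fun i => (ev i)⁻¹ : Fin (m + 2) → ℝ) (Fin.last m).succ
    rwa [Fin.cons_succ, Real.norm_of_nonneg h0] at this

/-- block structure and properties of the inverse of the bordered
matrix `B = [[H, 1],[1ᵀ, 0]]` for a symmetric `H` with `H 1 = 0` that is positive
definite on `1⊥` with eigenvalues `ev 0 ≥ … ≥ ev (M−2) > 0` there (encoded via the
characteristic polynomial): `B` is invertible, `B⁻¹ = [[Θ, (1/M)1],[(1/M)1ᵀ, 0]]`,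
`Θ` is symmetric, `Θ1 = 0`, `ΘHΘ = Θ`, the eigenvalues of `Θ` are `0` and the `1/ev i`,
`‖Θ‖₂ = 1/ev (M−2)`, and `(1 − 1/M)/ev 0 ≤ Θ_{kk} ≤ 1/ev (M−2)` for all `k`. -/
theorem stmt_18 (m : ℕ) (H : Matrix (Fin (m + 2)) (Fin (m + 2)) ℝ)
    (ev : Fin (m + 1) → ℝ)
    (hsymm : Hᵀ = H)
    (hH1 : H.mulVec (fun _ => (1 : ℝ)) = 0)
    (hmono : Antitone ev)
    (hpos : ∀ i, 0 < ev i)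
    (hchar : H.charpoly = X * ∏ i, (X - C (ev i))) :
    IsUnit (bordered H).det ∧
    (∀ k : Fin (m + 2),
      (bordered H)⁻¹ (Fin.castSucc k) (Fin.last (m + 2)) = 1 / ((m + 2 : ℕ) : ℝ) ∧
      (bordered H)⁻¹ (Fin.last (m + 2)) (Fin.castSucc k) = 1 / ((m + 2 : ℕ) : ℝ)) ∧
    (bordered H)⁻¹ (Fin.last (m + 2)) (Fin.last (m + 2)) = 0 ∧
    (∀ Θ : Matrix (Fin (m + 2)) (Fin (m + 2)) ℝ,
      (∀ k q, Θ k q = (bordered H)⁻¹ (Fin.castSucc k) (Fin.castSucc q)) →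
      Θᵀ = Θ ∧
      Θ.mulVec (fun _ => (1 : ℝ)) = 0 ∧
      Θ * H * Θ = Θ ∧
      Θ.charpoly = X * ∏ i, (X - C (ev i)⁻¹) ∧
      specNorm Θ = (ev (Fin.last m))⁻¹ ∧
      ∀ k : Fin (m + 2),
        (1 - 1 / ((m + 2 : ℕ) : ℝ)) / ev 0 ≤ Θ k k ∧ Θ k k ≤ (ev (Fin.last m))⁻¹) := by
  set d : Fin (m + 2) → ℝ := Fin.cons 0 ev with hd
  set e : Fin (m + 2) → ℝ := Fin.cons 0 fun i => (ev i)⁻¹ with he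
  obtain ⟨U, hU, rfl⟩ := exists_unitary_conj_diagonal (A := H) (d := d)
    (by rw [IsHermitian, conjTranspose_eq_transpose_of_trivial, hsymm])
    (by rw [hchar, Fin.prod_univ_succ (n := m + 1)]; simp [hd])
  have hUU := mem_unitaryGroup_iff'.1 hU
  have hcol := column_zero_mul hU (d := d)
    (fun i => Fin.cases (fun h => absurd rfl h) (fun j _ => by simpa [hd] using (hpos j).ne') i) hH1
  set T := U * diagonal e * star U with hTdef
  have hTsymm : Tᵀ = T := by
    ext k l
    rw [transpose_apply, hTdef, unitary_conj_diagonal_apply, unitary_conj_diagonal_apply]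
    simp only [mul_comm (U l _)]
  have hmul : ∀ a b : Fin (m + 2) → ℝ, (U * diagonal a * star U) * (U * diagonal b * star U) =
      U * diagonal (fun i => a i * b i) * star U := by
    intro a b
    rw [← diagonal_mul_diagonal]
    simp only [mul_assoc]
    rw [← mul_assoc (star U) U, hUU, one_mul]
  have hede : (fun i => e i * d i * e i) = e := by
    funext i
    refine Fin.cases (by simp [he]) (fun j => ?_) i
    simp [he, hd, (hpos j).ne']
  have hTHT : T * (U * diagonal d * star U) * T = T := by
    rw [hTdef, hmul, hmul, hede]
  have hTd : T * T * (U * diagonal d * star U) = T := by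
    rw [hTdef, hmul, hmul]
    simp only [mul_right_comm (e _) (e _), hede]
  have hT1 : T.mulVec (fun _ => (1 : ℝ)) = 0 := by
    rw [← hTd, ← mulVec_mulVec, hH1, mulVec_zero]
  have hrow : ∀ k l, ∑ j : Fin (m + 1), U k j.succ * U l j.succ =
      (1 : Matrix (Fin (m + 2)) (Fin (m + 2)) ℝ) k l - 1 / ((m + 2 : ℕ) : ℝ) := by
    intro k l
    rw [← mem_unitaryGroup_iff.1 hU, mul_apply, Fin.sum_univ_succ (n := m + 1), ← hcol k l]
    simp [star_apply]
  have hHT : ∀ k l, (U * diagonal d * star U * T) k l =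
      (1 : Matrix (Fin (m + 2)) (Fin (m + 2)) ℝ) k l - 1 / ((m + 2 : ℕ) : ℝ) := by
    intro k l
    rw [hTdef, hmul, unitary_conj_diagonal_apply, Fin.sum_univ_succ, ← hrow]
    simp [hd, he, (hpos _).ne']
  have hBC := bordered_mul_scaledBordered (M := m + 2) (by positivity) hH1
    (by rw [hTsymm, hT1]) hHT
  have hinv := inv_eq_right_inv hBC
  refine ⟨isUnit_det_of_right_inverse hBC, fun k => ?_, ?_, fun Θ hΘ => ?_⟩
  · rw [hinv]
    simp [scaledBordered]
  · rw [hinv]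
    simp [scaledBordered]
  · obtain rfl : Θ = T := by
      ext k q
      rw [hΘ, hinv]
      simp [scaledBordered]
    have hdiag : ∀ k, T k k = ∑ j : Fin (m + 1), (ev j)⁻¹ * (U k j.succ * U k j.succ) := by
      intro k
      rw [hTdef, unitary_conj_diagonal_apply, Fin.sum_univ_succ]
      simp [he]
    refine ⟨hTsymm, hT1, hTHT, ?_, ?_, fun k => ⟨?_, ?_⟩⟩
    · rw [hTdef, charpoly_unitary_conj_diagonal hU, Fin.prod_univ_succ]
      simp [he]
    · rw [hTdef, specNorm_unitary_conj_diagonal hU, norm_cons_zero_inv hmono hpos]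
    · have := hrow k k
      rw [one_apply_eq] at this
      rw [hdiag, ← this, div_eq_inv_mul, Finset.mul_sum]
      exact Finset.sum_le_sum fun j _ => mul_le_mul_of_nonneg_right
        (inv_anti₀ (hpos _) (hmono (Fin.zero_le j))) (mul_self_nonneg _)
    · have h := hrow k k
      rw [one_apply_eq] at h
      calc T k k ≤ ∑ j : Fin (m + 1), (ev (Fin.last m))⁻¹ * (U k j.succ * U k j.succ) := by
            rw [hdiag]
            exact Finset.sum_le_sum fun j _ => mul_le_mul_of_nonneg_right
              (inv_anti₀ (hpos _) (hmono (Fin.le_last j))) (mul_self_nonneg _)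
        _ = (ev (Fin.last m))⁻¹ * (1 - 1 / ((m + 2 : ℕ) : ℝ)) := by rw [← Finset.mul_sum, h]
        _ ≤ (ev (Fin.last m))⁻¹ :=
            mul_le_of_le_one_right (inv_pos.2 (hpos _)).le (sub_le_self _ (by positivity))
end
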